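/- arXiv:1607.04690 — 4 statements merged into one kernel-verified Lean document; each statement's English description precedes it below -/
import Mathlib

section
/- Let X and Y be probabilistic coherence spaces. Then X⊸Y is a probabilistic coherence space and X⊗Y is a probabilistic coherence space; i.e., besides biorthogonal closure, they satisfy: for every point (a,b) of the web there is an element of the P-set with strictly positive (a,b)-coefficient, and for every point (a,b) of the web the (a,b)-coefficients of elements of the P-set are bounded above. -/
open scoped ENNReal NNReal Classical

noncomputable section

namespace PCS

variable {I J K : Type*}

/-- Pairing `⟨u,u'⟩ = Σ_a u_a u'_a`, valued in `[0,∞]`. -/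
def pair (u u' : I → ℝ≥0) : ℝ≥0∞ := ∑' a, (u a : ℝ≥0∞) * (u' a : ℝ≥0∞)

/-- Orthogonal of a set of nonnegative families. -/
def orth (F : Set (I → ℝ≥0)) : Set (I → ℝ≥0) := {u' | ∀ u ∈ F, pair u u' ≤ 1}

/-- `P` is (the set of vectors of) a probabilistic coherence space on the web `I`. -/
structure IsPCS (P : Set (I → ℝ≥0)) : Prop where
  biorth : orth (orth P) = P
  pos : ∀ a : I, ∃ u ∈ P, 0 < u a
  bdd : ∀ a : I, ∃ A : ℝ≥0, 0 < A ∧ ∀ u ∈ P, u a ≤ A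

/-- Application of a matrix to a vector: `(t·u)_b = Σ_a t_{a,b} u_a ∈ [0,∞]`. -/
def matApp (t : I × J → ℝ≥0) (u : I → ℝ≥0) : J → ℝ≥0∞ :=
  fun b => ∑' a, (t (a, b) : ℝ≥0∞) * (u a : ℝ≥0∞)

/-- Application for `[0,∞]`-valued matrices/vectors. -/
def matAppE (t : I × J → ℝ≥0∞) (u : I → ℝ≥0∞) : J → ℝ≥0∞ :=
  fun b => ∑' a, t (a, b) * u a

/-- A `[0,∞]`-valued vector belongs to `Q ⊆ (ℝ≥0)^J` if it is pointwise the coercion of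
an element of `Q` (in particular it is everywhere finite). -/
def memP (Q : Set (J → ℝ≥0)) (v : J → ℝ≥0∞) : Prop :=
  ∃ w ∈ Q, ∀ b, v b = (w b : ℝ≥0∞)

/-- `t` is a morphism from `(I,P)` to `(J,Q)`: `t·u ∈ Q` for every `u ∈ P`. -/
def IsMorphism (t : I × J → ℝ≥0) (P : Set (I → ℝ≥0)) (Q : Set (J → ℝ≥0)) : Prop :=
  ∀ u ∈ P, memP Q (matApp t u)

/-- Matrix composition `(t ∘ s)_{a,c} = Σ_b s_{a,b} t_{b,c}`, in `[0,∞]`. -/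
def matComp (s : I × J → ℝ≥0) (t : J × K → ℝ≥0) : I × K → ℝ≥0∞ :=
  fun p => ∑' b, (s (p.1, b) : ℝ≥0∞) * (t (b, p.2) : ℝ≥0∞)

/-- Composition of `[0,∞]`-valued matrices. -/
def matCompE (s : I × J → ℝ≥0∞) (t : J × K → ℝ≥0∞) : I × K → ℝ≥0∞ :=
  fun p => ∑' b, s (p.1, b) * t (b, p.2)

/-- Set of simple tensors `u⊗v` with `u ∈ P`, `v ∈ Q`. -/
def tensSet (P : Set (I → ℝ≥0)) (Q : Set (J → ℝ≥0)) : Set (I × J → ℝ≥0) :=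
  {w | ∃ u ∈ P, ∃ v ∈ Q, w = fun p => u p.1 * v p.2}

/-- `P(X⊗Y)`: biorthogonal closure of the simple tensors. -/
def tensorP (P : Set (I → ℝ≥0)) (Q : Set (J → ℝ≥0)) : Set (I × J → ℝ≥0) :=
  orth (orth (tensSet P Q))

/-- `P(X⊸Y) = P((X ⊗ Y⊥)⊥)`. -/
def limplP (P : Set (I → ℝ≥0)) (Q : Set (J → ℝ≥0)) : Set (I × J → ℝ≥0) :=
  orth (tensorP P (orth Q))

/-- Norm `‖u‖_X = sup{⟨u,u'⟩ : u' ∈ P(X)⊥}`. -/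
def normE (P : Set (I → ℝ≥0)) (u : I → ℝ≥0) : ℝ≥0∞ :=
  ⨆ u' ∈ orth P, pair u u'

/-- The product `&_{i} X_i`. -/
def withP {ι : Type*} {A : ι → Type*} (P : ∀ i, Set (A i → ℝ≥0)) :
    Set ((Σ i, A i) → ℝ≥0) :=
  {u | ∀ i, (fun a => u ⟨i, a⟩) ∈ P i}

/-- The coproduct `⊕_{i} X_i = (&_{i} X_i⊥)⊥`. -/
def plusP {ι : Type*} {A : ι → Type*} (P : ∀ i, Set (A i → ℝ≥0)) :
    Set ((Σ i, A i) → ℝ≥0) :=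
  orth (withP fun i => orth (P i))

/-- Projection matrix `π_i`. -/
def projMat {ι : Type*} {A : ι → Type*} (i : ι) : ((Σ j, A j) × A i) → ℝ≥0 :=
  fun p => if p.1 = ⟨i, p.2⟩ then 1 else 0

/-- Injection matrix `in_j`. -/
def injMat {ι : Type*} {A : ι → Type*} (j : ι) : (A j × Σ i, A i) → ℝ≥0 :=
  fun p => if p.2 = ⟨j, p.1⟩ then 1 else 0

/-- `u^m = Π_a u_a^{m(a)}`. -/
def mpow (u : I → ℝ≥0) (m : Multiset I) : ℝ≥0 := (m.map u).prod

/-- `v^m` for `[0,∞]`-valued `v`. -/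
def mpowE (v : I → ℝ≥0∞) (m : Multiset I) : ℝ≥0∞ := (m.map v).prod

/-- Promotion `u^! = (u^m)_m`. -/
def promote (u : I → ℝ≥0) : Multiset I → ℝ≥0 := fun m => mpow u m

/-- `P(!X)`: biorthogonal closure of the promotions. -/
def bangP (P : Set (I → ℝ≥0)) : Set (Multiset I → ℝ≥0) :=
  orth (orth {v | ∃ u ∈ P, v = promote u})

/-- The function associated with a matrix `s ∈ (ℝ≥0)^{Mfin(I)×J}`:
`ŝ(u)_b = Σ_m s_{m,b} u^m`. -/
def fhat (s : Multiset I × J → ℝ≥0) (u : I → ℝ≥0) : J → ℝ≥0∞ :=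
  fun b => ∑' m : Multiset I, (s (m, b) : ℝ≥0∞) * (mpow u m : ℝ≥0∞)

/-- Factorial of a multiset: `m! = Π_a m(a)!`. -/
def mfact [DecidableEq I] (m : Multiset I) : ℕ :=
  (m.dedup.map fun a => (m.count a).factorial).prod

/-- Multisets over `I × J` with first marginal `c` and second marginal `d`. -/
def marg (c : Multiset I) (d : Multiset J) : Set (Multiset (I × J)) :=
  {r | r.map Prod.fst = c ∧ r.map Prod.snd = d}

/-- The exponential of a matrix: `(!t)_{c,d} = Σ_{r ∈ L(c,d)} (d!/r!) t^r`. -/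
def bangMatE [DecidableEq I] [DecidableEq J] (t : I × J → ℝ≥0∞) :
    Multiset I × Multiset J → ℝ≥0∞ :=
  fun p => ∑' r : marg p.1 p.2,
    ((mfact p.2 : ℝ≥0∞) / (mfact r.1 : ℝ≥0∞)) * mpowE t r.1

theorem pair_comm (u v : I → ℝ≥0) : pair u v = pair v u := by
  simp only [pair, mul_comm]

theorem subset_orth_orth (F : Set (I → ℝ≥0)) : F ⊆ orth (orth F) := fun u hu v hv => by
  rw [pair_comm]
  exact hv u hu

theorem orth_antitone {F G : Set (I → ℝ≥0)} (h : F ⊆ G) : orth G ⊆ orth F :=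
  fun _ hu v hv => hu v (h hv)

theorem orth_orth_orth (F : Set (I → ℝ≥0)) : orth (orth (orth F)) = orth F :=
  (orth_antitone (subset_orth_orth F)).antisymm (subset_orth_orth (orth F))

/-- A coordinate at which some element of `F` is positive is bounded on `orth F`. -/
theorem exists_bound_orth {F : Set (I → ℝ≥0)} {a : I} (h : ∃ u ∈ F, 0 < u a) :
    ∃ A : ℝ≥0, 0 < A ∧ ∀ v ∈ orth F, v a ≤ A := by
  obtain ⟨u, hu, hpos⟩ := h
  refine ⟨(u a)⁻¹, inv_pos.2 hpos, fun v hv => ?_⟩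
  have hle : (u a : ℝ≥0∞) * (v a : ℝ≥0∞) ≤ 1 :=
    (ENNReal.le_tsum (f := fun i => (u i : ℝ≥0∞) * (v i : ℝ≥0∞)) a).trans (hv u hu)
  have hle' : u a * v a ≤ 1 := by exact_mod_cast hle
  rwa [← mul_one (u a)⁻¹, le_inv_mul_iff₀ hpos]

/-- A coordinate bounded on `F` is positive at some element of `orth F`. -/
theorem exists_pos_orth {F : Set (I → ℝ≥0)} {a : I}
    (h : ∃ A : ℝ≥0, 0 < A ∧ ∀ u ∈ F, u a ≤ A) : ∃ v ∈ orth F, 0 < v a := by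
  obtain ⟨A, hA, hF⟩ := h
  refine ⟨Pi.single a A⁻¹, fun u hu => ?_, by simpa using hA⟩
  rw [pair, tsum_eq_single a fun b hb => by simp [Pi.single_eq_of_ne hb], Pi.single_eq_same]
  have hle : u a * A⁻¹ ≤ 1 := (mul_inv_le_iff₀ hA).2 (by simpa using hF u hu)
  exact_mod_cast hle

/-- The orthogonal of a coordinatewise positive and bounded set is a probabilistic coherence
space. -/
theorem isPCS_orth {F : Set (I → ℝ≥0)} (hpos : ∀ a, ∃ u ∈ F, 0 < u a)
    (hbdd : ∀ a, ∃ A : ℝ≥0, 0 < A ∧ ∀ u ∈ F, u a ≤ A) : IsPCS (orth F) where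
  biorth := orth_orth_orth F
  pos a := exists_pos_orth (hbdd a)
  bdd a := exists_bound_orth (hpos a)

theorem IsPCS.orth {P : Set (I → ℝ≥0)} (hP : IsPCS P) : IsPCS (orth P) :=
  isPCS_orth hP.pos hP.bdd

theorem IsPCS.tensorP {P : Set (I → ℝ≥0)} {Q : Set (J → ℝ≥0)} (hP : IsPCS P) (hQ : IsPCS Q) :
    IsPCS (tensorP P Q) := by
  refine IsPCS.orth (isPCS_orth ?_ ?_)
  · rintro ⟨a, b⟩
    obtain ⟨u, hu, hua⟩ := hP.pos a
    obtain ⟨v, hv, hvb⟩ := hQ.pos b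
    exact ⟨_, ⟨u, hu, v, hv, rfl⟩, mul_pos hua hvb⟩
  · rintro ⟨a, b⟩
    obtain ⟨A, hA, hPA⟩ := hP.bdd a
    obtain ⟨B, hB, hQB⟩ := hQ.bdd b
    refine ⟨A * B, mul_pos hA hB, ?_⟩
    rintro _ ⟨u, hu, v, hv, rfl⟩
    exact mul_le_mul' (hPA u hu) (hQB v hv)

/-- `X⊸Y` and `X⊗Y` are probabilistic coherence spaces. -/
theorem limpl_tensor_pcs {I J : Type*} [Countable I] [Countable J]
    (P : Set (I → ℝ≥0)) (Q : Set (J → ℝ≥0)) (hP : IsPCS P) (hQ : IsPCS Q) :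
    IsPCS (limplP P Q) ∧ IsPCS (tensorP P Q) := by
  exact ⟨(hP.tensorP hQ.orth).orth, hP.tensorP hQ⟩

end PCS
end
end

section
/- Let X₁, X₂, Y₁, Y₂ be probabilistic coherence spaces and let s₁ ∈ PCOH(X₁,Y₁), s₂ ∈ PCOH(X₂,Y₂). Define s₁⊗s₂ ∈ (ℝ≥0)^{(|X₁|×|X₂|)×(|Y₁|×|Y₂|)} by (s₁⊗s₂)_{((a₁,a₂),(b₁,b₂))} = (s₁)_{(a₁,b₁)} (s₂)_{(a₂,b₂)}. Then s₁⊗s₂ ∈ PCOH(X₁⊗X₂, Y₁⊗Y₂), and moreover (s₁⊗s₂)·(u₁⊗u₂) = (s₁·u₁)⊗(s₂·u₂) for all u₁ ∈ P(X₁), u₂ ∈ P(X₂). -/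
open scoped ENNReal NNReal Classical

noncomputable section

namespace PCS

variable {I J K : Type*}

/-- The transpose of `t` is adjoint to `t` for the pairing. -/
theorem tsum_matApp_mul (t : I × J → ℝ≥0) (u : I → ℝ≥0) (v : J → ℝ≥0) :
    ∑' b, matApp t u b * (v b : ℝ≥0∞) =
      ∑' a, (u a : ℝ≥0∞) * matApp (fun p : J × I => t (p.2, p.1)) v a := by
  simp only [matApp, ← ENNReal.tsum_mul_left, ← ENNReal.tsum_mul_right]
  rw [ENNReal.tsum_comm]
  refine tsum_congr fun a => tsum_congr fun b => ?_
  ring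

/-- A family bounded at every coordinate has, at each coordinate, an orthogonal vector that is
positive there. -/
theorem exists_mem_orth_pos {G : Set (J → ℝ≥0)} {b : J} {A : ℝ≥0} (hA : 0 < A)
    (hG : ∀ v ∈ G, v b ≤ A) : ∃ w ∈ orth G, 0 < w b := by
  refine ⟨Pi.single b A⁻¹, fun v hv => ?_, by simpa using hA⟩
  rw [pair, tsum_eq_single b fun c hc => by simp [hc]]
  rw [Pi.single_eq_same, ← ENNReal.coe_mul, ENNReal.coe_le_one_iff]
  calc v b * A⁻¹ ≤ A * A⁻¹ := by gcongr; exact hG v hv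
    _ = 1 := mul_inv_cancel₀ hA.ne'

/-- To be a morphism between biorthogonal closures, it suffices to map generators into the
target. -/
theorem isMorphism_orth_orth {t : I × J → ℝ≥0} {F : Set (I → ℝ≥0)} {G : Set (J → ℝ≥0)}
    (hF : ∀ a, ∃ u ∈ F, 0 < u a) (hG : ∀ b, ∃ w ∈ orth G, 0 < w b)
    (h : ∀ u ∈ F, memP (orth (orth G)) (matApp t u)) :
    IsMorphism t (orth (orth F)) (orth (orth G)) := by
  have transpose_le : ∀ w ∈ orth G, ∀ u ∈ F,
      ∑' a, (u a : ℝ≥0∞) * matApp (fun p : J × I => t (p.2, p.1)) w a ≤ 1 := by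
    intro w hw u hu
    obtain ⟨v, hv, hvt⟩ := h u hu
    rw [← tsum_matApp_mul]
    simpa only [pair, hvt, mul_comm] using hv w hw
  have bound : ∀ z ∈ orth (orth F), ∀ w ∈ orth G,
      ∑' b, matApp t z b * (w b : ℝ≥0∞) ≤ 1 := by
    intro z hz w hw
    have finite : ∀ a, matApp (fun p : J × I => t (p.2, p.1)) w a ≠ ∞ := by
      intro a htop
      obtain ⟨u, hu, hpos⟩ := hF a
      have hle := (ENNReal.le_tsum a).trans (transpose_le w hw u hu)
      rw [htop, ENNReal.mul_top (by simpa using hpos.ne')] at hle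
      simp at hle
    have hmem : (fun a => (matApp (fun p : J × I => t (p.2, p.1)) w a).toNNReal) ∈ orth F := by
      intro u hu
      simpa only [pair, ENNReal.coe_toNNReal (finite _)] using transpose_le w hw u hu
    rw [tsum_matApp_mul]
    simpa only [pair, ENNReal.coe_toNNReal (finite _), mul_comm] using hz _ hmem
  intro z hz
  have finite : ∀ b, matApp t z b ≠ ∞ := by
    intro b htop
    obtain ⟨w, hw, hpos⟩ := hG b
    have hle := (ENNReal.le_tsum b).trans (bound z hz w hw)
    rw [htop, ENNReal.top_mul (by simpa using hpos.ne')] at hle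
    simp at hle
  refine ⟨fun b => (matApp t z b).toNNReal, fun w hw => ?_,
    fun b => (ENNReal.coe_toNNReal (finite b)).symm⟩
  simpa only [pair, ENNReal.coe_toNNReal (finite _), mul_comm] using bound z hz w hw

/-- A tensor product of matrices acts componentwise on simple tensors. -/
theorem matApp_tensor {I₁ I₂ J₁ J₂ : Type*} (s₁ : I₁ × J₁ → ℝ≥0) (s₂ : I₂ × J₂ → ℝ≥0)
    (u₁ : I₁ → ℝ≥0) (u₂ : I₂ → ℝ≥0) (q : J₁ × J₂) :
    matApp (fun p : (I₁ × I₂) × (J₁ × J₂) => s₁ (p.1.1, p.2.1) * s₂ (p.1.2, p.2.2))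
        (fun p : I₁ × I₂ => u₁ p.1 * u₂ p.2) q
      = matApp s₁ u₁ q.1 * matApp s₂ u₂ q.2 := by
  simp only [matApp, ← ENNReal.tsum_mul_left, ← ENNReal.tsum_mul_right]
  rw [ENNReal.tsum_prod', ENNReal.tsum_comm]
  refine tsum_congr fun a₂ => tsum_congr fun a₁ => ?_
  push_cast
  ring

/-- Tensor product of morphisms is a morphism between the tensor products, and acts as
expected on simple tensors. -/
theorem tensor_of_morphisms {I₁ I₂ J₁ J₂ : Type*}
    [Countable I₁] [Countable I₂] [Countable J₁] [Countable J₂]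
    (P₁ : Set (I₁ → ℝ≥0)) (P₂ : Set (I₂ → ℝ≥0)) (Q₁ : Set (J₁ → ℝ≥0)) (Q₂ : Set (J₂ → ℝ≥0))
    (hP₁ : IsPCS P₁) (hP₂ : IsPCS P₂) (hQ₁ : IsPCS Q₁) (hQ₂ : IsPCS Q₂)
    (s₁ : I₁ × J₁ → ℝ≥0) (s₂ : I₂ × J₂ → ℝ≥0)
    (hs₁ : IsMorphism s₁ P₁ Q₁) (hs₂ : IsMorphism s₂ P₂ Q₂) :
    IsMorphism (fun p : (I₁ × I₂) × (J₁ × J₂) => s₁ (p.1.1, p.2.1) * s₂ (p.1.2, p.2.2))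
        (tensorP P₁ P₂) (tensorP Q₁ Q₂) ∧
    ∀ u₁ ∈ P₁, ∀ u₂ ∈ P₂, ∀ q : J₁ × J₂,
      matApp (fun p : (I₁ × I₂) × (J₁ × J₂) => s₁ (p.1.1, p.2.1) * s₂ (p.1.2, p.2.2))
          (fun p : I₁ × I₂ => u₁ p.1 * u₂ p.2) q
        = matApp s₁ u₁ q.1 * matApp s₂ u₂ q.2 := by
  refine ⟨isMorphism_orth_orth ?_ ?_ ?_, fun u₁ _ u₂ _ q => matApp_tensor s₁ s₂ u₁ u₂ q⟩
  · rintro ⟨a₁, a₂⟩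
    obtain ⟨u₁, hu₁, hpos₁⟩ := hP₁.pos a₁
    obtain ⟨u₂, hu₂, hpos₂⟩ := hP₂.pos a₂
    exact ⟨_, ⟨u₁, hu₁, u₂, hu₂, rfl⟩, mul_pos hpos₁ hpos₂⟩
  · rintro ⟨b₁, b₂⟩
    obtain ⟨A₁, hA₁, hle₁⟩ := hQ₁.bdd b₁
    obtain ⟨A₂, hA₂, hle₂⟩ := hQ₂.bdd b₂
    refine exists_mem_orth_pos (mul_pos hA₁ hA₂) ?_
    rintro _ ⟨v₁, hv₁, v₂, hv₂, rfl⟩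
    exact mul_le_mul' (hle₁ v₁ hv₁) (hle₂ v₂ hv₂)
  · rintro _ ⟨u₁, hu₁, u₂, hu₂, rfl⟩
    obtain ⟨v₁, hv₁, heq₁⟩ := hs₁ u₁ hu₁
    obtain ⟨v₂, hv₂, heq₂⟩ := hs₂ u₂ hu₂
    refine ⟨_, subset_orth_orth _ ⟨v₁, hv₁, v₂, hv₂, rfl⟩, fun q => ?_⟩
    rw [matApp_tensor, heq₁, heq₂, ENNReal.coe_mul]

end PCS
end
end

section
/- Let X and Y be probabilistic coherence spaces and t ∈ PCOH(X,Y). Define !t ∈ [0,∞]^{Mfin(|X|)×Mfin(|Y|)} by (!t)_{c,d} = Σ_{r∈L(c,d)} (d!/r!) t^r, where L(c,d) is the set of finite multisets r over |X|×|Y| such that Σ_{b∈|Y|} r(a,b) = c(a) for all a ∈ |X| and Σ_{a∈|X|} r(a,b) = d(b) for all b ∈ |Y|, d! = Π_b d(b)!, r! = Π_{(a,b)} r(a,b)!, and t^r = Π_{(a,b)} t_{(a,b)}^{r(a,b)}. Then for every u ∈ P(X) one has (!t)·u^! = (t·u)^!. -/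
open scoped ENNReal NNReal Classical

noncomputable section

namespace PCS

variable {I J K : Type*}

theorem mfact_eq_prod [DecidableEq I] (m : Multiset I) (s : Finset I) (h : m.toFinset ⊆ s) :
    mfact m = ∏ a ∈ s, (m.count a).factorial := by
  rw [← Finset.prod_subset h]
  · rfl
  · intro a _ ha
    rw [Multiset.mem_toFinset] at ha
    simp [Multiset.count_eq_zero_of_notMem ha]

theorem mfact_cons [DecidableEq I] (a : I) (m : Multiset I) :
    mfact (a ::ₘ m) = (m.count a + 1) * mfact m := by
  have ha : a ∈ insert a m.toFinset := Finset.mem_insert_self _ _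
  rw [mfact_eq_prod (a ::ₘ m) (insert a m.toFinset) (by simp),
    mfact_eq_prod m (insert a m.toFinset) (Finset.subset_insert _ _),
    ← Finset.mul_prod_erase _ _ ha, ← Finset.mul_prod_erase _ _ ha,
    Multiset.count_cons_self, Nat.factorial_succ, mul_assoc]
  congr 2
  refine Finset.prod_congr rfl fun x hx => ?_
  rw [Multiset.count_cons_of_ne (Finset.ne_of_mem_erase hx)]

theorem tsum_count_pair [DecidableEq I] [DecidableEq J] (r : Multiset (I × J)) (b : J) :
    ∑' a, (r.count (a, b) : ℝ≥0∞) = ((r.map Prod.snd).count b : ℝ≥0∞) := by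
  induction r using Multiset.induction with
  | empty => simp
  | cons x r ih =>
    obtain ⟨a', b'⟩ := x
    simp only [Multiset.count_cons, Multiset.map_cons, Nat.cast_add, ENNReal.tsum_add, ih]
    congr 1
    by_cases hb : b = b'
    · subst hb
      rw [tsum_eq_single a' (by intro a ha; simp [ha])]
      simp
    · simp [hb]

/-- The contribution of `r` to the multinomial expansion of `∏_{b ∈ d} ∑_a w_{a,b}`. -/
def multinomialTerm [DecidableEq I] [DecidableEq J] (w : I × J → ℝ≥0∞) (d : Multiset J)
    (r : Multiset (I × J)) : ℝ≥0∞ :=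
  if r.map Prod.snd = d then ((mfact d : ℝ≥0∞) / (mfact r : ℝ≥0∞)) * mpowE w r else 0

theorem natCast_div_mfact_cons [DecidableEq I] (a : I) (r : Multiset I) (x : ℝ≥0∞) :
    ((a ::ₘ r).count a : ℝ≥0∞) * (x / (mfact (a ::ₘ r) : ℝ≥0∞)) = x / (mfact r : ℝ≥0∞) := by
  rw [mfact_cons, Multiset.count_cons_self, Nat.cast_mul, ← mul_div_assoc,
    ENNReal.mul_div_mul_left _ _ (Nat.cast_ne_zero.mpr (Nat.succ_ne_zero _))
      (ENNReal.natCast_ne_top _)]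

theorem multinomialTerm_cons_eq_tsum [DecidableEq I] [DecidableEq J] (w : I × J → ℝ≥0∞) (b : J)
    (d : Multiset J) (r : Multiset (I × J)) :
    multinomialTerm w (b ::ₘ d) r = ∑' a, (r.count (a, b) : ℝ≥0∞) *
      if r.map Prod.snd = b ::ₘ d then
        ((mfact d : ℝ≥0∞) / (mfact r : ℝ≥0∞)) * mpowE w r else 0 := by
  rw [ENNReal.tsum_mul_right, tsum_count_pair, multinomialTerm]
  split_ifs with h
  · rw [h, Multiset.count_cons_self, mfact_cons, Nat.cast_mul, mul_div_assoc, mul_assoc]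
  · rw [mul_zero]

theorem tsum_multinomialTerm_cons [DecidableEq I] [DecidableEq J] (w : I × J → ℝ≥0∞) (b : J)
    (d : Multiset J) :
    ∑' r, multinomialTerm w (b ::ₘ d) r = (∑' a, w (a, b)) * ∑' r, multinomialTerm w d r := by
  simp_rw [multinomialTerm_cons_eq_tsum]
  rw [ENNReal.tsum_comm, ← ENNReal.tsum_mul_right]
  refine tsum_congr fun a => ?_
  rw [← Function.Injective.tsum_eq (g := Multiset.cons (a, b))
    fun _ _ => (Multiset.cons_inj_right _).mp, ← ENNReal.tsum_mul_left]
  · refine tsum_congr fun r => ?_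
    simp only [Multiset.map_cons, Multiset.cons_inj_right, multinomialTerm, mul_ite, mul_zero]
    split_ifs
    · rw [← mul_assoc, natCast_div_mfact_cons, mpowE, Multiset.map_cons, Multiset.prod_cons,
        mul_left_comm, mpowE]
    · rfl
  · intro r hr
    have hmem : (a, b) ∈ r := by
      by_contra h
      simp [Multiset.count_eq_zero_of_notMem h] at hr
    exact ⟨r.erase (a, b), Multiset.cons_erase hmem⟩

theorem tsum_multinomialTerm [DecidableEq I] [DecidableEq J] (w : I × J → ℝ≥0∞)
    (d : Multiset J) :
    ∑' r, multinomialTerm w d r = mpowE (fun b => ∑' a, w (a, b)) d := by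
  induction d using Multiset.induction with
  | empty =>
    rw [tsum_eq_single 0]
    · simp [multinomialTerm, mpowE, mfact]
    · intro r hr
      simp [multinomialTerm, hr]
  | cons b d ih =>
    rw [tsum_multinomialTerm_cons, ih, mpowE, mpowE, Multiset.map_cons, Multiset.prod_cons]

theorem coe_promote (u : I → ℝ≥0) (m : Multiset I) :
    (promote u m : ℝ≥0∞) = mpowE (fun a => (u a : ℝ≥0∞)) m := by
  induction m using Multiset.induction with
  | empty => simp [promote, mpow, mpowE]
  | cons a m ih => simp_all [promote, mpow, mpowE]

theorem bangMatE_app_eq_tsum [DecidableEq I] [DecidableEq J] (t : I × J → ℝ≥0∞) (v : I → ℝ≥0∞)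
    (d : Multiset J) :
    matAppE (bangMatE t) (mpowE v) d =
      ∑' r, multinomialTerm (fun q => t q * v q.1) d r := by
  have h (c : Multiset I) : bangMatE t (c, d) * mpowE v c = ∑' r : Multiset (I × J),
      if c = r.map Prod.fst then multinomialTerm (fun q => t q * v q.1) d r else 0 := by
    rw [bangMatE, ← ENNReal.tsum_mul_right,
      tsum_subtype (marg c d) fun r : Multiset (I × J) =>
        ((mfact d : ℝ≥0∞) / (mfact r : ℝ≥0∞)) * mpowE t r * mpowE v c]
    refine tsum_congr fun r => ?_
    rw [Set.indicator_apply]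
    by_cases hc : c = r.map Prod.fst
    · subst hc
      simp [marg, multinomialTerm, mpowE, Multiset.prod_map_mul, mul_assoc]
    · simp [marg, hc, Ne.symm hc]
  simp_rw [matAppE, h]
  rw [ENNReal.tsum_comm]
  exact tsum_congr fun r => tsum_ite_eq _ _

/-- Lemma 3.12: `(!t)·u^! = (t·u)^!` for every morphism `t` and every `u ∈ P(X)`. -/
theorem bang_app_promote {I J : Type*} [Countable I] [Countable J]
    [DecidableEq I] [DecidableEq J]
    (P : Set (I → ℝ≥0)) (Q : Set (J → ℝ≥0)) (hP : IsPCS P) (hQ : IsPCS Q)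
    (t : I × J → ℝ≥0) (ht : IsMorphism t P Q) :
    ∀ u ∈ P, ∀ d : Multiset J,
      matAppE (bangMatE fun q => (t q : ℝ≥0∞)) (fun m => (promote u m : ℝ≥0∞)) d
        = mpowE (matApp t u) d := by
  intro u _ d
  simp_rw [coe_promote]
  exact (bangMatE_app_eq_tsum _ _ d).trans (tsum_multinomialTerm _ d)

end PCS
end
end

section
/- Let N be the pair with web ℕ and P(N) = {u ∈ (ℝ≥0)^ℕ : Σ_{n∈ℕ} u_n ≤ 1} (the set of sub-probability distributions on ℕ; it satisfies P(N)⊥⊥ = P(N)). Let X be a probabilistic coherence space, let k ≥ 1, and let t ∈ (ℝ≥0)^{Mfin(ℕ)×|X|} be such that: (a) for every u ∈ P(N), the family t̂(u), defined by t̂(u)_c = Σ_{μ∈Mfin(ℕ)} t_{μ,c} u^μ, belongs to P(X); and (b) t_{μ,c} = 0 whenever the support of the finite multiset μ is not contained in {0,1,…,k−1}. Let m ∈ (ℝ≥0)^{|X|} be the vector of coefficients of the unitary monomial, m_c = t_{([0,1,…,k−1],c)}, where [0,1,…,k−1] is the multiset containing each of 0,…,k−1 exactly once. Then k^{−k}·m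 ∈ P(X). -/
open scoped ENNReal NNReal Classical

noncomputable section

namespace PCS

variable {I J K : Type*}

/-- `P(N)`: the sub-probability distributions on ℕ. -/
def PN : Set (ℕ → ℝ≥0) := {u | ∑' n, (u n : ℝ≥0∞) ≤ 1}

theorem orth_of_le {F : Set (I → ℝ≥0)} {u v : I → ℝ≥0} (hv : v ∈ orth F)
    (h : ∀ a, u a ≤ v a) : u ∈ orth F := fun w hw =>
  (ENNReal.tsum_le_tsum fun a => by gcongr; exact h a).trans (hv w hw)

theorem IsPCS.mem_of_le {P : Set (I → ℝ≥0)} (hP : IsPCS P) {u v : I → ℝ≥0} (hv : v ∈ P)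
    (h : ∀ a, u a ≤ v a) : u ∈ P := by
  rw [← hP.biorth] at hv ⊢
  exact orth_of_le hv h

/-- The uniform distribution on `{0, …, k-1}`. -/
def unif (k : ℕ) : ℕ → ℝ≥0 := fun n => if n < k then (k : ℝ≥0)⁻¹ else 0

theorem unif_mem_PN (k : ℕ) : unif k ∈ PN := by
  have h : ∑' n, (unif k n : ℝ≥0∞) = ∑ n ∈ Finset.range k, (unif k n : ℝ≥0∞) :=
    tsum_eq_sum fun n hn => by
      have hn' : ¬ n < k := by simpa using hn
      simp [unif, hn']
  have h' : ∑ n ∈ Finset.range k, unif k n = k * (k : ℝ≥0)⁻¹ := by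
    have hc : ∀ n ∈ Finset.range k, unif k n = (k : ℝ≥0)⁻¹ := fun n hn =>
      if_pos (Finset.mem_range.1 hn)
    simp [Finset.sum_congr rfl hc]
  change ∑' n, (unif k n : ℝ≥0∞) ≤ 1
  rw [h, ← ENNReal.ofNNReal_finsetSum, h']
  exact_mod_cast mul_inv_le_one

theorem mpow_unif_range (k : ℕ) : mpow (unif k) (Multiset.range k) = ((k : ℝ≥0) ^ k)⁻¹ := by
  have h : (Multiset.range k).map (unif k) = (Multiset.range k).map fun _ => (k : ℝ≥0)⁻¹ :=
    Multiset.map_congr rfl fun n hn => if_pos (Multiset.mem_range.1 hn)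
  simp [mpow, h]

/-- Lemma 5.1(1): the vector of coefficients of the unitary monomial of a power series
with `k` parameters sending `P(N)` into `P(X)`, rescaled by `k^{-k}`, belongs to `P(X)`. -/
theorem unitary_monomial_coeff {J : Type*} [Countable J]
    (Q : Set (J → ℝ≥0)) (hQ : IsPCS Q)
    (k : ℕ) (hk : 1 ≤ k) (t : Multiset ℕ × J → ℝ≥0)
    (ha : ∀ u ∈ PN, memP Q (fhat t u))
    (hb : ∀ (μ : Multiset ℕ) (c : J), ¬ (∀ n ∈ μ, n < k) → t (μ, c) = 0) :
    (fun c => ((k : ℝ≥0) ^ k)⁻¹ * t (Multiset.range k, c)) ∈ Q := by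
  obtain ⟨w, hw, hwt⟩ := ha _ (unif_mem_PN k)
  refine hQ.mem_of_le hw fun c => ?_
  have h := ENNReal.le_tsum (f := fun m : Multiset ℕ =>
    (t (m, c) : ℝ≥0∞) * (mpow (unif k) m : ℝ≥0∞)) (Multiset.range k)
  have h' := h.trans (hwt c).le
  rw [mpow_unif_range] at h'
  rw [mul_comm]
  exact_mod_cast h'

end PCS
end
end
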